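/- Case 23 of Theorem 1.2: the hypergeometric group Γ(f,g) generated by the companion matrices A and B of f(x) = x^5 - x^4 - x^3 + x^2 + x - 1 and g(x) = x^5 + x^4 + x + 1 is an arithmetic subgroup of the integral orthogonal group O_Q(ℤ): Γ(f,g) is contained in O_Q(ℤ) (in particular Aᵀ·Q·A = Q and Bᵀ·Q·B = Q), and Γ(f,g) has finite index in O_Q(ℤ). -/

import Mathlib

open Matrix

/-- The companion matrix `A` of `f(x) = x^5 - x^4 - x^3 + x^2 + x - 1`. -/
def matA : Matrix (Fin 5) (Fin 5) ℤ :=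
  !![(0 : ℤ), 0, 0, 0, 1; 1, 0, 0, 0, -1; 0, 1, 0, 0, -1; 0, 0, 1, 0, 1; 0, 0, 0, 1, 1]

/-- The companion matrix `B` of `g(x) = x^5 + x^4 + x + 1`. -/
def matB : Matrix (Fin 5) (Fin 5) ℤ :=
  !![(0 : ℤ), 0, 0, 0, -1; 1, 0, 0, 0, -1; 0, 1, 0, 0, 0; 0, 0, 1, 0, 0; 0, 0, 0, 1, -1]

/-- The symmetric integer matrix `Q` of the quadratic form preserved by `Γ(f,g)`. -/
def matQ : Matrix (Fin 5) (Fin 5) ℤ :=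
  !![(1 : ℤ), -3, 1, 1, 1; -3, 1, -3, 1, 1; 1, -3, 1, -3, 1; 1, 1, -3, 1, -3; 1, 1, 1, -3, 1]

/-- The integral orthogonal group `O_Q(ℤ)` of a matrix `Q`, as the subgroup of `GL₅(ℤ)`
consisting of all `M` with `Mᵀ * Q * M = Q`. -/
def orthogonalSubgroup (Q : Matrix (Fin 5) (Fin 5) ℤ) : Subgroup (GL (Fin 5) ℤ) where
  carrier := { M : GL (Fin 5) ℤ |
      (M : Matrix (Fin 5) (Fin 5) ℤ)ᵀ * Q * (M : Matrix (Fin 5) (Fin 5) ℤ) = Q }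
  one_mem' := by simp
  mul_mem' := by
    intro a b ha hb
    simp only [Set.mem_setOf_eq, Units.val_mul, transpose_mul] at ha hb ⊢
    calc ((b : Matrix (Fin 5) (Fin 5) ℤ)ᵀ * (a : Matrix (Fin 5) (Fin 5) ℤ)ᵀ) * Q *
          ((a : Matrix (Fin 5) (Fin 5) ℤ) * (b : Matrix (Fin 5) (Fin 5) ℤ))
        = (b : Matrix (Fin 5) (Fin 5) ℤ)ᵀ *
            ((a : Matrix (Fin 5) (Fin 5) ℤ)ᵀ * Q * (a : Matrix (Fin 5) (Fin 5) ℤ)) *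
            (b : Matrix (Fin 5) (Fin 5) ℤ) := by
          simp only [mul_assoc]
      _ = Q := by rw [ha, hb]
  inv_mem' := by
    intro a ha
    simp only [Set.mem_setOf_eq] at ha ⊢
    calc ((a⁻¹ : GL (Fin 5) ℤ) : Matrix (Fin 5) (Fin 5) ℤ)ᵀ * Q *
          ((a⁻¹ : GL (Fin 5) ℤ) : Matrix (Fin 5) (Fin 5) ℤ)
        = ((a⁻¹ : GL (Fin 5) ℤ) : Matrix (Fin 5) (Fin 5) ℤ)ᵀ *
            ((a : Matrix (Fin 5) (Fin 5) ℤ)ᵀ * Q * (a : Matrix (Fin 5) (Fin 5) ℤ)) *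
            ((a⁻¹ : GL (Fin 5) ℤ) : Matrix (Fin 5) (Fin 5) ℤ) := by rw [ha]
      _ = ((a : Matrix (Fin 5) (Fin 5) ℤ) *
            ((a⁻¹ : GL (Fin 5) ℤ) : Matrix (Fin 5) (Fin 5) ℤ))ᵀ * Q *
          ((a : Matrix (Fin 5) (Fin 5) ℤ) *
            ((a⁻¹ : GL (Fin 5) ℤ) : Matrix (Fin 5) (Fin 5) ℤ)) := by
          simp only [transpose_mul, mul_assoc]
      _ = Q := by rw [Units.mul_inv]; simp

/-- Change of basis taking `Q` to the form `8ab + 8cd + z²`. -/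
def matS : Matrix (Fin 5) (Fin 5) ℤ :=
  !![1, 0, 1, -1, -1; -1, 0, 0, 0, 0; -1, 1, -1, 1, 1; 0, 0, -1, 0, 0; 1, -1, 1, 0, -1]

/-- The inverse of `matS`. -/
def matSi : Matrix (Fin 5) (Fin 5) ℤ :=
  !![0, -1, 0, 0, 0; 1, 0, 1, 0, 0; 0, 0, 0, -1, 0; 0, 0, 1, 0, 1; -1, -1, -1, -1, -1]

/-- The Gram matrix `4U ⊕ 4U ⊕ ⟨1⟩`. -/
def matK : Matrix (Fin 5) (Fin 5) ℤ :=
  !![0, 4, 0, 0, 0; 4, 0, 0, 0, 0; 0, 0, 0, 4, 0; 0, 0, 4, 0, 0; 0, 0, 0, 0, 1]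

/-- `A` in the new basis. -/
def mata : Matrix (Fin 5) (Fin 5) ℤ :=
  !![0, -1, 0, 1, 0; -1, 0, 0, 0, 0; 0, 0, 0, -1, 0; -1, 0, -1, 0, 0; 0, 0, 0, 0, 1]

/-- `B` in the new basis. -/
def matb : Matrix (Fin 5) (Fin 5) ℤ :=
  !![0, -1, 0, 1, 0; -2, 1, -1, 0, 1; 1, -1, 1, -1, -1; -2, 1, -2, 0, 1; 4, -4, 4, 0, -3]

lemma matS_mul_matSi : matS * matSi = 1 := by decide +kernel
lemma matSi_mul_matS : matSi * matS = 1 := by decide +kernel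
lemma matS_form : matSᵀ * matQ * matS = matK := by decide +kernel

/-- `M` is, in the new basis, an element of `H`. -/
def InH (H : Subgroup (GL (Fin 5) ℤ)) (M : Matrix (Fin 5) (Fin 5) ℤ) : Prop :=
  (∃ g ∈ H, (g : Matrix (Fin 5) (Fin 5) ℤ) * matS = matS * M) ∧ Mᵀ * matK * M = matK

section
variable {H : Subgroup (GL (Fin 5) ℤ)} {M N : Matrix (Fin 5) (Fin 5) ℤ}

lemma isom_mul (hM : Mᵀ * matK * M = matK) (hN : Nᵀ * matK * N = matK) :
    (M * N)ᵀ * matK * (M * N) = matK := by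
  calc (M * N)ᵀ * matK * (M * N) = Nᵀ * (Mᵀ * matK * M) * N := by
        simp only [transpose_mul, mul_assoc]
    _ = matK := by rw [hM, hN]

lemma InH.mul (hM : InH H M) (hN : InH H N) : InH H (M * N) := by
  obtain ⟨⟨g, hg, e⟩, oM⟩ := hM
  obtain ⟨⟨k, hk, e'⟩, oN⟩ := hN
  refine ⟨⟨g * k, H.mul_mem hg hk, ?_⟩, isom_mul oM oN⟩
  rw [Units.val_mul, mul_assoc, e', ← mul_assoc, e, mul_assoc]

lemma InH.step {P : Matrix (Fin 5) (Fin 5) ℤ} (hM : InH H M) (hN : InH H N) (h : M * N = P) :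
    InH H P := h ▸ hM.mul hN

lemma InH.one : InH H 1 := ⟨⟨1, H.one_mem, by simp⟩, by simp⟩

lemma InH.inv (hM : InH H M) (h : M * N = 1) : InH H N := by
  obtain ⟨⟨g, hg, e⟩, oM⟩ := hM
  refine ⟨⟨g⁻¹, H.inv_mem hg, ?_⟩, ?_⟩
  · calc ((g⁻¹ : GL (Fin 5) ℤ) : Matrix (Fin 5) (Fin 5) ℤ) * matS
        = (g⁻¹ : GL (Fin 5) ℤ) * (matS * (M * N)) := by rw [h, mul_one]
      _ = (g⁻¹ : GL (Fin 5) ℤ) * ((g : Matrix (Fin 5) (Fin 5) ℤ) * matS) * N := by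
          rw [e]; simp only [mul_assoc]
      _ = matS * N := by rw [← mul_assoc, Units.inv_mul, one_mul]
  · calc Nᵀ * matK * N = (M * N)ᵀ * matK * (M * N) := by
          conv_lhs => rw [← oM]
          simp only [transpose_mul, mul_assoc]
      _ = matK := by rw [h]; simp

lemma InH.family (f : ℤ → Matrix (Fin 5) (Fin 5) ℤ) (h0 : f 0 = 1)
    (hadd : ∀ k l, f k * f l = f (k + l)) (h1 : InH H (f 1)) (k : ℤ) : InH H (f k) := by
  induction k using Int.induction_on with
  | zero => rw [h0]; exact InH.one
  | succ n ih => rw [← hadd]; exact ih.mul h1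
  | pred n ih =>
    have hm : InH H (f (-1)) := h1.inv (by rw [hadd]; simpa using h0)
    rw [sub_eq_add_neg, ← hadd]; exact ih.mul hm

end

/-- Eichler transvection attached to the second isotropic vector. -/
def Ef (p q r : ℤ) : Matrix (Fin 5) (Fin 5) ℤ :=
  !![1, 0, 0, 0, 0; -(p * q + 2 * r ^ 2), 1, -q, -p, -r; p, 0, 1, 0, 0; q, 0, 0, 1, 0;
    4 * r, 0, 0, 0, 1]

/-- Eichler transvection attached to the first isotropic vector. -/
def Ee (p q r : ℤ) : Matrix (Fin 5) (Fin 5) ℤ :=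
  !![1, -(p * q + 2 * r ^ 2), -q, -p, -r; 0, 1, 0, 0, 0; 0, p, 1, 0, 0; 0, q, 0, 1, 0;
    0, 4 * r, 0, 0, 1]

/-- Eichler transvection attached to the fourth isotropic vector. -/
def Fz (r : ℤ) : Matrix (Fin 5) (Fin 5) ℤ :=
  !![1, 0, 0, 0, 0; 0, 1, 0, 0, 0; 0, 0, 1, 0, 0; 0, 0, -2 * r ^ 2, 1, -r; 0, 0, 4 * r, 0, 1]

/-- Eichler transvection attached to the third isotropic vector. -/
def Ez (r : ℤ) : Matrix (Fin 5) (Fin 5) ℤ :=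
  !![1, 0, 0, 0, 0; 0, 1, 0, 0, 0; 0, 0, 1, -2 * r ^ 2, -r; 0, 0, 0, 1, 0; 0, 0, 0, 4 * r, 1]

/-- Swap inside the first plane, with a sign. -/
def mσ : Matrix (Fin 5) (Fin 5) ℤ :=
  !![0, -1, 0, 0, 0; -1, 0, 0, 0, 0; 0, 0, 1, 0, 0; 0, 0, 0, 1, 0; 0, 0, 0, 0, 1]

/-- Swap of the two planes, with a sign. -/
def mτ : Matrix (Fin 5) (Fin 5) ℤ :=
  !![0, 0, -1, 0, 0; 0, 0, 0, -1, 0; 1, 0, 0, 0, 0; 0, 1, 0, 0, 0; 0, 0, 0, 0, 1]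

/-- The inverse of `mτ`. -/
def mτi : Matrix (Fin 5) (Fin 5) ℤ :=
  !![0, 0, 1, 0, 0; 0, 0, 0, 1, 0; -1, 0, 0, 0, 0; 0, -1, 0, 0, 0; 0, 0, 0, 0, 1]

/-- Swap inside the second plane, with a sign. -/
def mρ : Matrix (Fin 5) (Fin 5) ℤ :=
  !![1, 0, 0, 0, 0; 0, 1, 0, 0, 0; 0, 0, 0, -1, 0; 0, 0, -1, 0, 0; 0, 0, 0, 0, 1]

/-- Negation of both planes. -/
def mν : Matrix (Fin 5) (Fin 5) ℤ :=
  !![-1, 0, 0, 0, 0; 0, -1, 0, 0, 0; 0, 0, -1, 0, 0; 0, 0, 0, -1, 0; 0, 0, 0, 0, 1]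

/-- The finitely many residual elements. -/
def mD (s t : ℤ) : Matrix (Fin 5) (Fin 5) ℤ :=
  !![1, 0, 0, 0, 0; 0, 1, 0, 0, 0; 0, 0, s, 0, 0; 0, 0, 0, s, 0; 0, 0, 0, 0, t]

lemma Ef_mul (p q r p' q' r' : ℤ) :
    Ef p q r * Ef p' q' r' = Ef (p + p') (q + q') (r + r') := by
  ext i j
  fin_cases i <;> fin_cases j <;> simp [Ef, Matrix.mul_apply, Fin.sum_univ_five] <;> ring

lemma Fz_mul (r r' : ℤ) : Fz r * Fz r' = Fz (r + r') := by
  ext i j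
  fin_cases i <;> fin_cases j <;> simp [Fz, Matrix.mul_apply, Fin.sum_univ_five] <;> ring

lemma Ee_eq (p q r : ℤ) : Ee p q r = mσ * Ef (-p) (-q) (-r) * mσ := by
  ext i j
  fin_cases i <;> fin_cases j <;> simp [Ee, Ef, mσ, Matrix.mul_apply, Fin.sum_univ_five]

lemma Ez_eq (r : ℤ) : Ez r = mρ * Fz (-r) * mρ := by
  ext i j
  fin_cases i <;> fin_cases j <;> simp [Ez, Fz, mρ, Matrix.mul_apply, Fin.sum_univ_five]

lemma Ef_zero : Ef 0 0 0 = 1 := by decide +kernel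
lemma Fz_zero : Fz 0 = 1 := by decide +kernel

/-- The list of elements of the group used in the reduction. -/
structure Good (H : Subgroup (GL (Fin 5) ℤ)) : Prop where
  ef : ∀ p q r, InH H (Ef p q r)
  ee : ∀ p q r, InH H (Ee p q r)
  fz : ∀ r, InH H (Fz r)
  ez : ∀ r, InH H (Ez r)
  sg : InH H mσ
  ta : InH H mτ
  rh : InH H mρ
  nu : InH H mν

lemma good_of_gens {H : Subgroup (GL (Fin 5) ℤ)} (ha : InH H mata) (hb : InH H matb) :
    Good H := by
  have a2 : InH H !![0, 0, -1, 0, 0; 0, 1, 0, -1, 0; 1, 0, 1, 0, 0; 0, 1, 0, 0, 0; 0, 0, 0, 0, 1] :=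
    ha.step ha (by decide +kernel)
  have a4 : InH H !![-1, 0, -1, 0, 0; 0, 0, 0, -1, 0; 1, 0, 0, 0, 0; 0, 1, 0, -1, 0; 0, 0, 0, 0, 1] :=
    a2.step a2 (by decide +kernel)
  have nu : InH H mν :=
    a4.step a2 (by decide +kernel)
  have a8 : InH H !![0, 0, 1, 0, 0; 0, -1, 0, 1, 0; -1, 0, -1, 0, 0; 0, -1, 0, 0, 0; 0, 0, 0, 0, 1] :=
    a4.step a4 (by decide +kernel)
  have a10 : InH H !![1, 0, 1, 0, 0; 0, 0, 0, 1, 0; -1, 0, 0, 0, 0; 0, -1, 0, 1, 0; 0, 0, 0, 0, 1] :=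
    a8.step a2 (by decide +kernel)
  have ai : InH H !![0, -1, 0, 0, 0; -1, 0, -1, 0, 0; 0, 1, 0, -1, 0; 0, 0, -1, 0, 0; 0, 0, 0, 0, 1] :=
    ha.inv (by decide +kernel)
  have b2 : InH H !![0, 0, -1, 0, 0; 1, 0, 2, -1, -1; 1, 0, 0, 0, 0; 0, 1, 1, 0, 0; 0, 0, -4, 0, 1] :=
    hb.step hb (by decide +kernel)
  have b3 : InH H !![-1, 1, -1, 1, 1; 0, 0, 0, -1, 0; 0, -1, 0, 1, 0; -1, 0, 0, -1, 0; 0, 0, 0, 4, 1] :=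
    b2.step hb (by decide +kernel)
  have b4 : InH H !![-1, 0, 0, 0, 0; 2, -1, 2, 0, -1; 0, 0, -1, 0, 0; 2, 0, 2, -1, -1; -4, 0, -4, 0, 1] :=
    b2.step b2 (by decide +kernel)
  have b6 : InH H !![0, 0, 1, 0, 0; 1, 0, 0, 1, 0; -1, 0, 0, 0, 0; 2, -1, 1, 0, -1; -4, 0, 0, 0, 1] :=
    b3.step b3 (by decide +kernel)
  have w1 : InH H !![-1, 0, -2, 1, 1; 0, 0, 1, 0, 0; 1, 0, 0, 0, 0; 0, 1, 1, 0, 0; 0, 0, -4, 0, 1] :=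
    b3.step ai (by decide +kernel)
  have sg : InH H mσ :=
    w1.step b6 (by decide +kernel)
  have w2 : InH H !![0, 1, 1, 0, 0; 0, -1, 0, 1, 0; -1, 1, -1, 1, 1; 0, -1, 0, 0, 0; 0, 4, 0, 0, 1] :=
    w1.step b3 (by decide +kernel)
  have w3 : InH H !![-1, 0, 0, -1, 0; 0, 0, -1, 0, 0; -2, 1, -1, 0, 1; 1, 0, 0, 0, 0; -4, 0, 0, 0, 1] :=
    w2.step ha (by decide +kernel)
  have w4 : InH H !![0, -1, 0, 0, 0; -1, 0, 0, 0, 0; 0, 0, 0, -1, 0; 0, 0, -1, 0, 0; 0, 0, 0, 0, 1] :=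
    w3.step b2 (by decide +kernel)
  have f1 : InH H (Ef 1 0 0) :=
    w4.step ha (by decide +kernel)
  have ta : InH H mτ :=
    f1.step a2 (by decide +kernel)
  have tai : InH H mτi := ta.inv (by decide +kernel)
  have w5 : InH H !![0, 0, -1, 0, 0; 0, 0, 0, -1, 0; 0, -1, 0, 0, 0; -1, 0, 0, 0, 0; 0, 0, 0, 0, 1] :=
    ta.step sg (by decide +kernel)
  have rh : InH H mρ := w5.step tai (by decide +kernel)
  have w6 : InH H !![1, 0, 0, 0, 0; 0, 1, 0, -1, 0; 0, 0, 0, -1, 0; -1, 0, -1, 0, 0; 0, 0, 0, 0, 1] :=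
    rh.step f1 (by decide +kernel)
  have f2 : InH H (Ef 0 1 0) := by
    have h : InH H (Ef 0 (-1) 0) := w6.step rh (by decide +kernel)
    exact h.inv (by rw [Ef_mul]; exact Ef_zero)
  have w7 : InH H !![-1, 0, -1, 0, 0; 2, 0, 2, -1, -1; 1, 0, 0, 0, 0; 0, 1, 0, -1, 0; -4, 0, -4, 0, 1] :=
    a10.step b4 (by decide +kernel)
  have f3 : InH H (Ef 0 0 1) :=
    w7.step a8 (by decide +kernel)
  have w8 : InH H !![0, 0, 1, 0, 0; 0, -1, 0, 1, 0; -1, 0, -1, 0, 0; 2, -1, 2, 0, -1; -4, 0, -4, 0, 1] :=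
    a2.step b4 (by decide +kernel)
  have z1 : InH H (Fz 1) :=
    w8.step a4 (by decide +kernel)
  have fz : ∀ r, InH H (Fz r) := InH.family Fz Fz_zero Fz_mul z1
  have ef : ∀ p q r, InH H (Ef p q r) := by
    intro p q r
    have h1 := InH.family (fun k => Ef k 0 0) Ef_zero (by intro k l; simp [Ef_mul]) f1 p
    have h2 := InH.family (fun k => Ef 0 k 0) Ef_zero (by intro k l; simp [Ef_mul]) f2 q
    have h3 := InH.family (fun k => Ef 0 0 k) Ef_zero (by intro k l; simp [Ef_mul]) f3 r
    have := (h1.mul h2).mul h3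
    simpa [Ef_mul] using this
  exact ⟨ef, fun p q r => Ee_eq p q r ▸ (sg.mul (ef _ _ _)).mul sg, fz,
    fun r => Ez_eq r ▸ (rh.mul (fz _)).mul rh, sg, ta, rh, nu⟩

lemma isom_entries {N : Matrix (Fin 5) (Fin 5) ℤ} (h : Nᵀ * matK * N = matK) (i j : Fin 5) :
    4 * (N 0 i * N 1 j + N 1 i * N 0 j) + 4 * (N 2 i * N 3 j + N 3 i * N 2 j) + N 4 i * N 4 j
      = matK i j := by
  rw [← h]
  simp [matK, Matrix.mul_apply, Fin.sum_univ_five]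
  ring

lemma four_dvd_of_sq {z k : ℤ} (h : z * z = 8 * k) : ∃ w, z = 4 * w ∧ 2 * (w * w) = k := by
  have h1 : (2 : ℤ) ∣ z := by
    have : (2 : ℤ) ∣ z * z := ⟨4 * k, by rw [h]; ring⟩
    exact (Int.prime_two.dvd_or_dvd this).elim id id
  obtain ⟨y, rfl⟩ := h1
  have h2 : y * y = 2 * k := by nlinarith
  have h3 : (2 : ℤ) ∣ y := by
    have : (2 : ℤ) ∣ y * y := ⟨k, h2⟩
    exact (Int.prime_two.dvd_or_dvd this).elim id id
  obtain ⟨w, rfl⟩ := h3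
  exact ⟨w, by ring, by nlinarith⟩

/-- Balanced division. -/
lemma balanced (z a : ℤ) (ha : a ≠ 0) : ∃ r, 2 * |z + r * a| ≤ |a| := by
  have h0 := Int.emod_nonneg z ha
  have h1 := Int.emod_lt_abs z ha
  have h2 := Int.emod_add_mul_ediv z a
  by_cases h : 2 * (z % a) ≤ |a|
  · refine ⟨-(z / a), ?_⟩
    have : z + -(z / a) * a = z % a := by linarith
    rw [this, abs_of_nonneg h0]; exact h
  · rcases abs_choice a with hh | hh
    · refine ⟨-(z / a) - 1, ?_⟩
      have : z + (-(z / a) - 1) * a = z % a - |a| := by rw [hh]; linarith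
      rw [this, abs_of_neg (by linarith)]; linarith
    · refine ⟨-(z / a) + 1, ?_⟩
      have : z + (-(z / a) + 1) * a = z % a - |a| := by rw [hh]; linarith
      rw [this, abs_of_neg (by linarith)]; linarith

/-- `N'` is obtained from `N` by left multiplication by an element of the group. -/
def Red (H : Subgroup (GL (Fin 5) ℤ)) (N N' : Matrix (Fin 5) (Fin 5) ℤ) : Prop :=
  ∃ M, InH H M ∧ M * N = N'

lemma Red.trans {H : Subgroup (GL (Fin 5) ℤ)} {N N' N'' : Matrix (Fin 5) (Fin 5) ℤ}
    (h : Red H N N') (h' : Red H N' N'') : Red H N N'' := by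
  obtain ⟨M, hM, rfl⟩ := h
  obtain ⟨M', hM', rfl⟩ := h'
  exact ⟨M' * M, hM'.mul hM, by rw [mul_assoc]⟩

lemma InH.red {H : Subgroup (GL (Fin 5) ℤ)} {M : Matrix (Fin 5) (Fin 5) ℤ} (h : InH H M)
    (N : Matrix (Fin 5) (Fin 5) ℤ) : Red H N (M * N) := ⟨M, h, rfl⟩

lemma Red.isom {H : Subgroup (GL (Fin 5) ℤ)} {N N' : Matrix (Fin 5) (Fin 5) ℤ}
    (h : Red H N N') (hN : Nᵀ * matK * N = matK) : N'ᵀ * matK * N' = matK := by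
  obtain ⟨M, hM, rfl⟩ := h
  exact isom_mul hM.2 hN

lemma abs_lt_of_small_prod {a b w : ℤ} (ha : a ≠ 0) (h : a * b = -(2 * (w * w))) (hw : 2 * |w| ≤ |a|) :
    |b| < |a| := by
  have h1 : |a| * |b| = 2 * (|w| * |w|) := by
    rw [← abs_mul, h, abs_neg, abs_mul, abs_mul]; norm_num
  have h2 : 0 < |a| := abs_pos.mpr ha
  have h3 := abs_nonneg w
  by_contra hc
  push Not at hc
  nlinarith

/-- First column: reduction to a multiple of the first basis vector. -/
lemma col0_aux {H : Subgroup (GL (Fin 5) ℤ)} (hH : Good H) : ∀ n : ℕ,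
    ∀ N : Matrix (Fin 5) (Fin 5) ℤ, Nᵀ * matK * N = matK → N 0 0 ≠ 0 → (N 0 0).natAbs = n →
    ∃ N', Red H N N' ∧ N' 1 0 = 0 ∧ N' 2 0 = 0 ∧ N' 3 0 = 0 ∧ N' 4 0 = 0 := by
  intro n
  induction n using Nat.strong_induction_on with
  | _ n ih =>
  intro N hN ha hn
  have e0 := isom_entries hN 0 0
  simp only [matK, of_apply, cons_val', cons_val_zero, cons_val_fin_one] at e0
  obtain ⟨w, hw, -⟩ := four_dvd_of_sq (z := N 4 0)
    (k := -(N 0 0 * N 1 0 + N 2 0 * N 3 0)) (by linarith)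
  obtain ⟨r, hr⟩ := balanced w (N 0 0) ha
  set p := -(N 2 0 / N 0 0) with hp
  set q := -(N 3 0 / N 0 0) with hq
  set N1 := Ef p q r * N with hN1
  have R1 : Red H N N1 := (hH.ef p q r).red N
  have o1 := R1.isom hN
  have x0 : N1 0 0 = N 0 0 := by simp [hN1, Ef, Matrix.mul_apply, Fin.sum_univ_five, -Matrix.cons_mul]
  have x2 : N1 2 0 = N 2 0 % N 0 0 := by
    have := Int.emod_add_mul_ediv (N 2 0) (N 0 0)
    simp [hN1, Ef, Matrix.mul_apply, Fin.sum_univ_five, -Matrix.cons_mul, hp]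
    linarith
  have x3 : N1 3 0 = N 3 0 % N 0 0 := by
    have := Int.emod_add_mul_ediv (N 3 0) (N 0 0)
    simp [hN1, Ef, Matrix.mul_apply, Fin.sum_univ_five, -Matrix.cons_mul, hq]
    linarith
  have x4 : N1 4 0 = 4 * (w + r * N 0 0) := by
    simp [hN1, Ef, Matrix.mul_apply, Fin.sum_univ_five, -Matrix.cons_mul, hw]
    ring
  have l2 : |N1 2 0| < |N 0 0| := by
    rw [x2, abs_of_nonneg (Int.emod_nonneg _ ha)]; exact Int.emod_lt_abs _ ha
  have l3 : |N1 3 0| < |N 0 0| := by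
    rw [x3, abs_of_nonneg (Int.emod_nonneg _ ha)]; exact Int.emod_lt_abs _ ha
  -- use of the induction hypothesis
  have key : ∀ N2, Red H N1 N2 → N2 0 0 ≠ 0 → |N2 0 0| < |N 0 0| →
      ∃ N', Red H N N' ∧ N' 1 0 = 0 ∧ N' 2 0 = 0 ∧ N' 3 0 = 0 ∧ N' 4 0 = 0 := by
    intro N2 R2 h h'
    obtain ⟨N', R3, h3⟩ := ih (N2 0 0).natAbs (by rw [← hn]; zify; exact h') N2 (R2.isom o1) h rfl
    exact ⟨N', (R1.trans R2).trans R3, h3⟩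
  by_cases c2 : N1 2 0 = 0
  · by_cases c3 : N1 3 0 = 0
    · have e1 := isom_entries o1 0 0
      simp only [matK, of_apply, cons_val', cons_val_zero, cons_val_fin_one] at e1
      rw [c2, c3, x4, x0] at e1
      have e2 : N 0 0 * N1 1 0 = -(2 * ((w + r * N 0 0) * (w + r * N 0 0))) := by nlinarith
      have l1 := abs_lt_of_small_prod ha e2 hr
      by_cases c1 : N1 1 0 = 0
      · refine ⟨N1, R1, c1, c2, c3, ?_⟩
        rw [c1] at e2
        have : w + r * N 0 0 = 0 := by nlinarith
        rw [x4, this]; rfl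
      · have y : (mσ * N1) 0 0 = -N1 1 0 := by
          simp [mσ, Matrix.mul_apply, Fin.sum_univ_five, -Matrix.cons_mul]
        exact key _ (hH.sg.red N1) (by rw [y]; simpa using c1) (by rw [y, abs_neg]; exact l1)
    · have y : (mσ * (mρ * (mτ * N1))) 0 0 = N1 3 0 := by
        simp [mσ, mρ, mτ, Matrix.mul_apply, Fin.sum_univ_five, -Matrix.cons_mul]
      exact key _ (((hH.ta.red N1).trans (hH.rh.red _)).trans (hH.sg.red _))
        (by rw [y]; exact c3) (by rw [y]; exact l3)
  · have y : (mτ * N1) 0 0 = -N1 2 0 := by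
      simp [mτ, Matrix.mul_apply, Fin.sum_univ_five, -Matrix.cons_mul]
    exact key _ (hH.ta.red N1) (by rw [y]; simpa using c2) (by rw [y, abs_neg]; exact l2)

lemma col0 {H : Subgroup (GL (Fin 5) ℤ)} (hH : Good H) (N : Matrix (Fin 5) (Fin 5) ℤ)
    (hN : Nᵀ * matK * N = matK) :
    ∃ N', Red H N N' ∧ N' 0 0 = 1 ∧ N' 1 0 = 0 ∧ N' 2 0 = 0 ∧ N' 3 0 = 0 ∧ N' 4 0 = 0 := by
  have step : ∃ N1, Red H N N1 ∧ N1 0 0 ≠ 0 := by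
    by_contra hc
    push Not at hc
    have h0 : N 0 0 = 0 := hc N ⟨1, InH.one, one_mul N⟩
    have h1 := hc _ (hH.sg.red N)
    have h2 := hc _ (hH.ta.red N)
    have h3 := hc _ ((hH.ta.red N).trans (hH.sg.red _))
    simp [mσ, mτ, Matrix.mul_apply, Fin.sum_univ_five, -Matrix.cons_mul] at h1 h2 h3
    have e0 := isom_entries hN 0 0
    have e1 := isom_entries hN 0 1
    simp [matK, h0, h1, h2, h3] at e0 e1
    simp [e0] at e1
  obtain ⟨N1, R1, h1⟩ := step
  obtain ⟨N2, R2, z1, z2, z3, z4⟩ := col0_aux hH _ N1 (R1.isom hN) h1 rfl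
  have o2 := R2.isom (R1.isom hN)
  have e1 := isom_entries o2 0 1
  simp [matK, z1, z2, z3, z4] at e1
  rcases Int.eq_one_or_neg_one_of_mul_eq_one e1 with h | h
  · exact ⟨N2, R1.trans R2, h, z1, z2, z3, z4⟩
  · refine ⟨mν * N2, (R1.trans R2).trans (hH.nu.red _), ?_, ?_, ?_, ?_, ?_⟩ <;>
      simp [mν, Matrix.mul_apply, Fin.sum_univ_five, -Matrix.cons_mul, h, z1, z2, z3, z4]

/-- `N` fixes the first hyperbolic plane. -/
def Fix2 (N : Matrix (Fin 5) (Fin 5) ℤ) : Prop :=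
  (N 0 0 = 1 ∧ N 1 0 = 0 ∧ N 2 0 = 0 ∧ N 3 0 = 0 ∧ N 4 0 = 0) ∧
  (N 0 1 = 0 ∧ N 1 1 = 1 ∧ N 2 1 = 0 ∧ N 3 1 = 0 ∧ N 4 1 = 0)

lemma col1 {H : Subgroup (GL (Fin 5) ℤ)} (hH : Good H) (N : Matrix (Fin 5) (Fin 5) ℤ)
    (hN : Nᵀ * matK * N = matK) : ∃ N', Red H N N' ∧ Fix2 N' := by
  obtain ⟨N1, R1, z0, z1, z2, z3, z4⟩ := col0 hH N hN
  have o1 := R1.isom hN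
  have e1 := isom_entries o1 0 1
  have e2 := isom_entries o1 1 1
  simp [matK, z0, z1, z2, z3, z4] at e1 e2
  obtain ⟨w, hw, -⟩ := four_dvd_of_sq (z := N1 4 1)
    (k := -(N1 0 1 * N1 1 1 + N1 2 1 * N1 3 1)) (by linarith)
  have R2 := (hH.ee (-N1 2 1) (-N1 3 1) (-w)).red N1
  refine ⟨_, R1.trans R2, ⟨?_, ?_, ?_, ?_, ?_⟩, ⟨?_, ?_, ?_, ?_, ?_⟩⟩ <;>
    simp [Ee, Matrix.mul_apply, Fin.sum_univ_five, -Matrix.cons_mul, z0, z1, z2, z3, z4, e1, hw]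
  rw [e1, hw] at e2
  nlinarith

lemma Fix2.rows {N : Matrix (Fin 5) (Fin 5) ℤ} (h : Fix2 N) (o : Nᵀ * matK * N = matK) :
    (N 0 2 = 0 ∧ N 0 3 = 0 ∧ N 0 4 = 0) ∧ (N 1 2 = 0 ∧ N 1 3 = 0 ∧ N 1 4 = 0) := by
  obtain ⟨⟨a0, a1, a2, a3, a4⟩, ⟨b0, b1, b2, b3, b4⟩⟩ := h
  have e02 := isom_entries o 0 2
  have e03 := isom_entries o 0 3
  have e04 := isom_entries o 0 4
  have e12 := isom_entries o 1 2
  have e13 := isom_entries o 1 3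
  have e14 := isom_entries o 1 4
  simp [matK, a0, a1, a2, a3, a4, b0, b1, b2, b3, b4] at e02 e03 e04 e12 e13 e14
  exact ⟨⟨e12, e13, e14⟩, ⟨e02, e03, e04⟩⟩

lemma Fix2.fz {N : Matrix (Fin 5) (Fin 5) ℤ} (h : Fix2 N) (r : ℤ) : Fix2 (Fz r * N) := by
  obtain ⟨⟨a0, a1, a2, a3, a4⟩, ⟨b0, b1, b2, b3, b4⟩⟩ := h
  refine ⟨⟨?_, ?_, ?_, ?_, ?_⟩, ⟨?_, ?_, ?_, ?_, ?_⟩⟩ <;>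
    simp [Fz, Matrix.mul_apply, Fin.sum_univ_five, -Matrix.cons_mul, *]

lemma Fix2.ez {N : Matrix (Fin 5) (Fin 5) ℤ} (h : Fix2 N) (r : ℤ) : Fix2 (Ez r * N) := by
  obtain ⟨⟨a0, a1, a2, a3, a4⟩, ⟨b0, b1, b2, b3, b4⟩⟩ := h
  refine ⟨⟨?_, ?_, ?_, ?_, ?_⟩, ⟨?_, ?_, ?_, ?_, ?_⟩⟩ <;>
    simp [Ez, Matrix.mul_apply, Fin.sum_univ_five, -Matrix.cons_mul, *]

lemma Fix2.rh {N : Matrix (Fin 5) (Fin 5) ℤ} (h : Fix2 N) : Fix2 (mρ * N) := by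
  obtain ⟨⟨a0, a1, a2, a3, a4⟩, ⟨b0, b1, b2, b3, b4⟩⟩ := h
  refine ⟨⟨?_, ?_, ?_, ?_, ?_⟩, ⟨?_, ?_, ?_, ?_, ?_⟩⟩ <;>
    simp [mρ, Matrix.mul_apply, Fin.sum_univ_five, -Matrix.cons_mul, *]

/-- Third column. -/
lemma col2_aux {H : Subgroup (GL (Fin 5) ℤ)} (hH : Good H) : ∀ n : ℕ,
    ∀ N : Matrix (Fin 5) (Fin 5) ℤ, Nᵀ * matK * N = matK → Fix2 N → N 2 2 ≠ 0 →
    (N 2 2).natAbs = n →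
    ∃ N', Red H N N' ∧ Fix2 N' ∧ N' 3 2 = 0 ∧ N' 4 2 = 0 := by
  intro n
  induction n using Nat.strong_induction_on with
  | _ n ih =>
  intro N hN hF ha hn
  obtain ⟨⟨r02, -, -⟩, ⟨r12, -, -⟩⟩ := hF.rows hN
  have e0 := isom_entries hN 2 2
  simp [matK, r02, r12] at e0
  obtain ⟨w, hw, hk⟩ := four_dvd_of_sq (z := N 4 2) (k := -(N 2 2 * N 3 2)) (by linarith)
  obtain ⟨r, hr⟩ := balanced w (N 2 2) ha
  set N1 := Fz r * N with hN1
  have R1 : Red H N N1 := (hH.fz r).red N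
  have o1 := R1.isom hN
  have F1 : Fix2 N1 := hF.fz r
  have x2 : N1 2 2 = N 2 2 := by simp [hN1, Fz, Matrix.mul_apply, Fin.sum_univ_five, -Matrix.cons_mul]
  have x4 : N1 4 2 = 4 * (w + r * N 2 2) := by
    simp [hN1, Fz, Matrix.mul_apply, Fin.sum_univ_five, -Matrix.cons_mul, hw]
    ring
  obtain ⟨⟨s02, -, -⟩, ⟨s12, -, -⟩⟩ := F1.rows o1
  have e1 := isom_entries o1 2 2
  simp [matK, s02, s12] at e1
  rw [x4, x2] at e1
  have e2 : N 2 2 * N1 3 2 = -(2 * ((w + r * N 2 2) * (w + r * N 2 2))) := by nlinarith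
  have l1 := abs_lt_of_small_prod ha e2 hr
  by_cases c1 : N1 3 2 = 0
  · refine ⟨N1, R1, F1, c1, ?_⟩
    rw [c1] at e2
    have : w + r * N 2 2 = 0 := by nlinarith
    rw [x4, this]; rfl
  · have y : (mρ * N1) 2 2 = -N1 3 2 := by
      simp [mρ, Matrix.mul_apply, Fin.sum_univ_five, -Matrix.cons_mul]
    have R2 := hH.rh.red N1
    have l2 : |(mρ * N1) 2 2| < |N 2 2| := by rw [y, abs_neg]; exact l1
    obtain ⟨N', R3, h3⟩ := ih _ (by rw [← hn]; zify; exact l2) (mρ * N1) (R2.isom o1) F1.rh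
      (by rw [y]; simpa using c1) rfl
    exact ⟨N', (R1.trans R2).trans R3, h3⟩

lemma full_reduction {H : Subgroup (GL (Fin 5) ℤ)} (hH : Good H)
    (N : Matrix (Fin 5) (Fin 5) ℤ) (hN : Nᵀ * matK * N = matK) :
    ∃ s t : ℤˣ, Red H N (mD s t) := by
  obtain ⟨N1, R1, F1⟩ := col1 hH N hN
  have o1 := R1.isom hN
  have step : ∃ N2, Red H N1 N2 ∧ Fix2 N2 ∧ N2 2 2 ≠ 0 := by
    by_contra hc
    push Not at hc
    have h0 : N1 2 2 = 0 := hc N1 ⟨1, InH.one, one_mul N1⟩ F1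
    have h1 := hc _ (hH.rh.red N1) F1.rh
    simp [mρ, Matrix.mul_apply, Fin.sum_univ_five, -Matrix.cons_mul] at h1
    obtain ⟨⟨r02, -, -⟩, ⟨r12, -, -⟩⟩ := F1.rows o1
    have e0 := isom_entries o1 2 2
    have e1 := isom_entries o1 2 3
    simp [matK, h0, h1, r02, r12] at e0 e1
    simp [e0] at e1
  obtain ⟨N2, R2, F2, h2⟩ := step
  have o2 := R2.isom o1
  obtain ⟨N3, R3, F3, z3, z4⟩ := col2_aux hH _ N2 o2 F2 h2 rfl
  have o3 := R3.isom o2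
  obtain ⟨⟨r02, r03, r04⟩, ⟨r12, r13, r14⟩⟩ := F3.rows o3
  have e23 := isom_entries o3 2 3
  have e33 := isom_entries o3 3 3
  simp [matK, r02, r12, r03, r13, z3, z4] at e23 e33
  obtain ⟨w, hw, hk⟩ := four_dvd_of_sq (z := N3 4 3) (k := -(N3 2 3 * N3 3 3)) (by linarith)
  have hs : N3 3 3 * N3 3 3 = 1 := by
    rcases Int.eq_one_or_neg_one_of_mul_eq_one' e23 with h | h <;> simp [h.2]
  have hss : N3 2 2 = N3 3 3 := by
    rcases Int.eq_one_or_neg_one_of_mul_eq_one' e23 with h | h <;> simp [h.1, h.2]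
  set N4 := Ez (-(w * N3 3 3)) * N3 with hN4
  have R4 : Red H N3 N4 := (hH.ez _).red N3
  have o4 := R4.isom o3
  have F4 : Fix2 N4 := F3.ez _
  obtain ⟨⟨s02, s03, s04⟩, ⟨s12, s13, s14⟩⟩ := F4.rows o4
  have y22 : N4 2 2 = N3 3 3 := by
    simp [hN4, Ez, Matrix.mul_apply, Fin.sum_univ_five, -Matrix.cons_mul, z3, z4, hss]
  have y32 : N4 3 2 = 0 := by
    simp [hN4, Ez, Matrix.mul_apply, Fin.sum_univ_five, -Matrix.cons_mul, z3]
  have y42 : N4 4 2 = 0 := by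
    simp [hN4, Ez, Matrix.mul_apply, Fin.sum_univ_five, -Matrix.cons_mul, z3, z4]
  have y33 : N4 3 3 = N3 3 3 := by
    simp [hN4, Ez, Matrix.mul_apply, Fin.sum_univ_five, -Matrix.cons_mul]
  have y43 : N4 4 3 = 0 := by
    simp [hN4, Ez, Matrix.mul_apply, Fin.sum_univ_five, -Matrix.cons_mul, hw]
    linear_combination (-4 * w) * hs
  have hne : N3 3 3 ≠ 0 := by intro h; simp [h] at hs
  have y23 : N4 2 3 = 0 := by
    have e := isom_entries o4 3 3
    simp [matK, s03, s13, y43, y33] at e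
    rcases mul_eq_zero.mp (show N4 2 3 * N3 3 3 = 0 by linarith) with h | h
    · exact h
    · exact absurd h hne
  have f24 := isom_entries o4 2 4
  have f34 := isom_entries o4 3 4
  have f44 := isom_entries o4 4 4
  simp [matK, s02, s12, s03, s13, s04, s14, y22, y32, y42, y23, y33, y43, hne] at f24 f34 f44
  simp [f24, f34] at f44
  obtain ⟨⟨a0, a1, a2, a3, a4⟩, ⟨b0, b1, b2, b3, b4⟩⟩ := F4
  refine ⟨⟨N3 3 3, N3 3 3, hs, hs⟩, ⟨N4 4 4, N4 4 4, f44, f44⟩, ?_⟩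
  have : N4 = mD (N3 3 3) (N4 4 4) := by
    ext i j
    fin_cases i <;> fin_cases j <;>
      simp [mD, a0, a1, a2, a3, a4, b0, b1, b2, b3, b4, s02, s03, s04, s12, s13, s14, y22, y32,
        y42, y23, y33, y43, f24, f34]
  have R := ((R1.trans R2).trans R3).trans R4
  rw [this] at R
  exact R

/-- Case 23 of Theorem 1.2: the hypergeometric group `Γ(f,g)` generated by the companion matrices `A`, `B`
of `f(x) = x^5 - x^4 - x^3 + x^2 + x - 1` and `g(x) = x^5 + x^4 + x + 1`
is an arithmetic subgroup of `O_Q(ℤ)`: it preserves `Q`, it is contained in `O_Q(ℤ)`,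
and it has finite index in `O_Q(ℤ)`. -/
theorem hypergeometric_group_arithmetic
    (A B : GL (Fin 5) ℤ)
    (hA : (A : Matrix (Fin 5) (Fin 5) ℤ) = matA)
    (hB : (B : Matrix (Fin 5) (Fin 5) ℤ) = matB) :
    matAᵀ * matQ * matA = matQ ∧
    matBᵀ * matQ * matB = matQ ∧
    Subgroup.closure {A, B} ≤ orthogonalSubgroup matQ ∧
    ((Subgroup.closure {A, B}).subgroupOf (orthogonalSubgroup matQ)).FiniteIndex := by
  have oA : matAᵀ * matQ * matA = matQ := by decide +kernel
  have oB : matBᵀ * matQ * matB = matQ := by decide +kernel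
  refine ⟨oA, oB, ?_, ?_⟩
  · rw [Subgroup.closure_le]
    rintro x (rfl | rfl)
    · change (_ : Matrix (Fin 5) (Fin 5) ℤ)ᵀ * _ * _ = _
      rw [hA]; exact oA
    · change (_ : Matrix (Fin 5) (Fin 5) ℤ)ᵀ * _ * _ = _
      rw [hB]; exact oB
  set H := Subgroup.closure {A, B} with hH
  have ha : InH H mata :=
    ⟨⟨A, Subgroup.subset_closure (by simp), by rw [hA]; decide +kernel⟩, by decide +kernel⟩
  have hb : InH H matb :=
    ⟨⟨B, Subgroup.subset_closure (by simp), by rw [hB]; decide +kernel⟩, by decide +kernel⟩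
  have hG := good_of_gens ha hb
  have main : ∀ g ∈ orthogonalSubgroup matQ, ∃ st : ℤˣ × ℤˣ, ∃ h ∈ H,
      ((h * g : GL (Fin 5) ℤ) : Matrix (Fin 5) (Fin 5) ℤ) * matS = matS * mD st.1 st.2 := by
    intro g hg
    have hg' : (g : Matrix (Fin 5) (Fin 5) ℤ)ᵀ * matQ * (g : Matrix (Fin 5) (Fin 5) ℤ) = matQ := hg
    have hS : matS * (matSi * (g : Matrix (Fin 5) (Fin 5) ℤ) * matS) = g * matS := by
      rw [← mul_assoc, ← mul_assoc, matS_mul_matSi, one_mul]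
    have hN : (matSi * (g : Matrix (Fin 5) (Fin 5) ℤ) * matS)ᵀ * matK *
        (matSi * (g : Matrix (Fin 5) (Fin 5) ℤ) * matS) = matK := by
      generalize matSi * (g : Matrix (Fin 5) (Fin 5) ℤ) * matS = N at hS
      calc Nᵀ * matK * N = (matS * N)ᵀ * matQ * (matS * N) := by
            rw [← matS_form]; simp only [transpose_mul, mul_assoc]
        _ = matSᵀ * ((g : Matrix (Fin 5) (Fin 5) ℤ)ᵀ * matQ * g) * matS := by
            rw [hS]; simp only [transpose_mul, mul_assoc]
        _ = matK := by rw [hg', matS_form]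
    obtain ⟨s, t, M, ⟨⟨h, hh, e⟩, -⟩, hM⟩ := full_reduction hG _ hN
    refine ⟨(s, t), h, hh, ?_⟩
    rw [Units.val_mul, mul_assoc, ← hS, ← mul_assoc, e, mul_assoc, hM]
  choose! st h hh hst using main
  have hfin : Finite (orthogonalSubgroup matQ ⧸ H.subgroupOf (orthogonalSubgroup matQ)) := by
    refine Finite.of_injective (β := ℤˣ × ℤˣ)
      (fun x => st ((x.out : orthogonalSubgroup matQ) : GL (Fin 5) ℤ)⁻¹) ?_
    intro x y hxy
    have mx := (orthogonalSubgroup matQ).inv_mem x.out.2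
    have my := (orthogonalSubgroup matQ).inv_mem y.out.2
    have ex := hst _ mx
    have ey := hst _ my
    simp only at hxy
    rw [hxy, ← ey] at ex
    have e2 : h (x.out : GL (Fin 5) ℤ)⁻¹ * (x.out : GL (Fin 5) ℤ)⁻¹
        = h (y.out : GL (Fin 5) ℤ)⁻¹ * (y.out : GL (Fin 5) ℤ)⁻¹ := by
      apply Units.ext
      have := congrArg (· * matSi) ex
      simpa only [mul_assoc, matS_mul_matSi, mul_one] using this
    rw [← QuotientGroup.out_eq' x, ← QuotientGroup.out_eq' y]
    rw [QuotientGroup.eq, Subgroup.mem_subgroupOf]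
    have e3 : ((x.out : GL (Fin 5) ℤ))⁻¹ * (y.out : GL (Fin 5) ℤ)
        = (h (x.out : GL (Fin 5) ℤ)⁻¹)⁻¹ * h (y.out : GL (Fin 5) ℤ)⁻¹ := by
      rw [eq_inv_mul_iff_mul_eq, ← mul_assoc, e2]; simp
    change ((x.out : GL (Fin 5) ℤ))⁻¹ * (y.out : GL (Fin 5) ℤ) ∈ H
    rw [e3]
    exact H.mul_mem (H.inv_mem (hh _ mx)) (hh _ my)
  exact Subgroup.finiteIndex_of_finite_quotient
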